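/- arXiv:1612.03279 — 2 statements merged into one kernel-verified Lean document; each statement's English description precedes it below -/
import Mathlib

section
/- The graph F(F_q, F_{q^2}) contains no 4-cycles: any two distinct points of F(F_q, F_{q^2}) are incident to at most one common line. Equivalently, if distinct points (a,b,c) ≠ (a',b',c') are both incident to lines [x,y,z] and [x',y',z'], then [x,y,z] = [x',y',z']. -/
/-- Incidence in the graph `F(F_q, F_{q^2})`: a point `(a,b,c) ∈ F_q × F_{q^2} × F_q` is
incident to a line `[x,y,z] ∈ F_{q^2} × F_{q^2} × F_q` iff `y - b = a·x` in `F_{q^2}` and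
`z - c = a·y + (a·y)^q` (an equation in `F_q` read in `F_{q^2}` via the embedding `f`). -/
def FIncident (q : ℕ) {F K : Type*} [Field F] [Field K] (f : F →+* K)
    (p : F × K × F) (l : K × K × F) : Prop :=
  l.2.1 - p.2.1 = f p.1 * l.1 ∧
  f (l.2.2 - p.2.2) = f p.1 * l.2.1 + (f p.1 * l.2.1) ^ q

/-- `F(F_q, F_{q^2})` contains no 4-cycles: two distinct points are incident to at most
one common line. -/
theorem no_four_cycles_field (q : ℕ) (F K : Type*) [Field F] [Fintype F] [Field K] [Fintype K]
    (hF : Fintype.card F = q) (hK : Fintype.card K = q ^ 2) (f : F →+* K) :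
    ∀ p p' : F × K × F, p ≠ p' → ∀ l l' : K × K × F,
      FIncident q f p l → FIncident q f p' l →
      FIncident q f p l' → FIncident q f p' l' → l = l' := by
  rintro ⟨a, b, c⟩ ⟨a', b', c'⟩ hp ⟨x, y, z⟩ ⟨x', y', z'⟩ ⟨h₁, h₂⟩ ⟨h₃, h₄⟩ ⟨h₅, h₆⟩ ⟨h₇, -⟩
  dsimp only at h₁ h₂ h₃ h₄ h₅ h₆ h₇
  have ha : a ≠ a' := by
    rintro rfl
    obtain rfl : b = b' := sub_right_injective (h₁.trans h₃.symm)
    obtain rfl : c = c' := sub_right_injective (f.injective (h₂.trans h₄.symm))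
    exact hp rfl
  have hx : (f a - f a') * (x - x') = 0 := by linear_combination h₃ - h₁ + h₅ - h₇
  obtain rfl : x = x' :=
    sub_eq_zero.mp ((mul_eq_zero.mp hx).resolve_left (sub_ne_zero.mpr (f.injective.ne ha)))
  obtain rfl : y = y' := sub_left_injective (h₁.trans h₅.symm)
  obtain rfl : z = z' := sub_left_injective (f.injective (h₂.trans h₆.symm))
  rfl
end

section
/- For every line [x,y,z] of the graph F(Z_n, Z_{n^2}) and every a ∈ Z_n, there exists a unique pair (b,c) ∈ Z_{n^2} × Z_n such that the point (a,b,c) is incident to the line [x,y,z]. Consequently, every line of F(Z_n, Z_{n^2}) is incident to exactly n points, so F(Z_n, Z_{n^2}) is bi-regular with bi-degrees (n, n^2). -/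
/-- Incidence in the graph `F(Z_n, Z_{n^2})`: a point `(a,b,c) ∈ Z_n × Z_{n^2} × Z_n` is
incident to a line `[x,y,z] ∈ Z_{n^2} × Z_{n^2} × Z_n` iff `y - b = ā·x` in `Z_{n^2}` and
`z - c = π(ā·y + ā·y^n)` in `Z_n`, where `ā ∈ Z_{n^2}` is the image of the canonical
representative of `a` and `π : Z_{n^2} → Z_n` is the canonical reduction map. -/
def ZIncident (n : ℕ) (p : ZMod n × ZMod (n ^ 2) × ZMod n)
    (l : ZMod (n ^ 2) × ZMod (n ^ 2) × ZMod n) : Prop :=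
  l.2.1 - p.2.1 = (p.1.val : ZMod (n ^ 2)) * l.1 ∧
  l.2.2 - p.2.2 = ZMod.castHom (dvd_pow_self n (two_ne_zero)) (ZMod n)
    ((p.1.val : ZMod (n ^ 2)) * l.2.1 + (p.1.val : ZMod (n ^ 2)) * l.2.1 ^ n)

/-- The points incident to a given line are parametrized by their first coordinate. -/
def pointsOnLineEquiv (n : ℕ) (l : ZMod (n ^ 2) × ZMod (n ^ 2) × ZMod n) :
    {p : ZMod n × ZMod (n ^ 2) × ZMod n // ZIncident n p l} ≃ ZMod n where
  toFun p := p.1.1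
  invFun a := ⟨(a, l.2.1 - (a.val : ZMod (n ^ 2)) * l.1,
    l.2.2 - ZMod.castHom (dvd_pow_self n two_ne_zero) (ZMod n)
      ((a.val : ZMod (n ^ 2)) * l.2.1 + (a.val : ZMod (n ^ 2)) * l.2.1 ^ n)),
    sub_sub_cancel _ _, sub_sub_cancel _ _⟩
  left_inv := by
    rintro ⟨⟨a, b, c⟩, hb, hc⟩
    refine Subtype.ext (Prod.ext rfl (Prod.ext ?_ ?_))
    · exact sub_eq_of_eq_add' (sub_eq_iff_eq_add.mp hb)
    · exact sub_eq_of_eq_add' (sub_eq_iff_eq_add.mp hc)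
  right_inv _ := rfl

/-- The lines incident to a given point are parametrized by their first coordinate. -/
def linesThroughPointEquiv (n : ℕ) (p : ZMod n × ZMod (n ^ 2) × ZMod n) :
    {l : ZMod (n ^ 2) × ZMod (n ^ 2) × ZMod n // ZIncident n p l} ≃ ZMod (n ^ 2) where
  toFun l := l.1.1
  invFun x := ⟨(x, (p.1.val : ZMod (n ^ 2)) * x + p.2.1,
    ZMod.castHom (dvd_pow_self n two_ne_zero) (ZMod n)
      ((p.1.val : ZMod (n ^ 2)) * ((p.1.val : ZMod (n ^ 2)) * x + p.2.1) +
        (p.1.val : ZMod (n ^ 2)) * ((p.1.val : ZMod (n ^ 2)) * x + p.2.1) ^ n) + p.2.2),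
    add_sub_cancel_right _ _, add_sub_cancel_right _ _⟩
  left_inv := by
    rintro ⟨⟨x, y, z⟩, hy, hz⟩
    dsimp only at hy hz
    obtain rfl := sub_eq_iff_eq_add.mp hy
    obtain rfl := sub_eq_iff_eq_add.mp hz
    rfl
  right_inv _ := rfl

/-- For every line `[x,y,z]` of `F(Z_n, Z_{n^2})` and every `a ∈ Z_n` there is a unique
pair `(b,c) ∈ Z_{n^2} × Z_n` with `(a,b,c)` incident to `[x,y,z]`; consequently every
line is incident to exactly `n` points, so `F(Z_n, Z_{n^2})` is bi-regular with
bi-degrees `(n, n^2)`. -/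
theorem line_degree_ring (n : ℕ) (hn : 2 ≤ n) :
    (∀ l : ZMod (n ^ 2) × ZMod (n ^ 2) × ZMod n, ∀ a : ZMod n,
      ∃! bc : ZMod (n ^ 2) × ZMod n, ZIncident n (a, bc.1, bc.2) l) ∧
    (∀ l : ZMod (n ^ 2) × ZMod (n ^ 2) × ZMod n,
      Nat.card {p : ZMod n × ZMod (n ^ 2) × ZMod n // ZIncident n p l} = n) ∧
    (∀ p : ZMod n × ZMod (n ^ 2) × ZMod n,
      Nat.card {l : ZMod (n ^ 2) × ZMod (n ^ 2) × ZMod n // ZIncident n p l} = n ^ 2) := by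
  refine ⟨fun l a => ?_, fun l => ?_, fun p => ?_⟩
  · refine ⟨((pointsOnLineEquiv n l).symm a).1.2, ((pointsOnLineEquiv n l).symm a).2, ?_⟩
    intro bc h
    exact congrArg (fun p => p.1.2) ((pointsOnLineEquiv n l).symm_apply_apply ⟨(a, bc), h⟩).symm
  · rw [Nat.card_congr (pointsOnLineEquiv n l), Nat.card_zmod]
  · rw [Nat.card_congr (linesThroughPointEquiv n p), Nat.card_zmod]
end
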